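/- Let k be a field of characteristic zero, m ≥ 2, and n = 2m (so n ≥ 4 is even). Let R = k[x₁,…,xₙ], f = x₁²+⋯+xₙ², and for p ∈ ℕ let G_p be the cokernel of the map R^{≥p−m} → R^{≥p−m+2} given by multiplication by f. Then: (i) Ext^j_R(G_p, R) = 0 for every natural number j ∉ {1, n−1}; (ii) Ext^1_R(G_p, R) is isomorphic to R/(f) as an R-module; (iii) Ext^{n−1}_R(G_p, R) is isomorphic, as a k-vector space, to the k-linear dual of the image in R/(f) of the space of polynomials of degree ≤ p−m+1. -/

import Mathlib

open CategoryTheory Opposite MvPolynomial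

noncomputable section

/-- The ideal `R^{≥q} = 𝔪^{max(q,0)}` of polynomials spanned by monomials of degree `≥ q`,
where `𝔪 = (x₁,…,xₙ)`. -/
def degGE (K : Type) [CommRing K] (n : ℕ) (q : ℤ) : Ideal (MvPolynomial (Fin n) K) :=
  (Ideal.span (Set.range (X : Fin n → MvPolynomial (Fin n) K))) ^ q.toNat

/-- The quadric `f = x₁² + ⋯ + xₙ²`. -/
def quadricSum (K : Type) [CommRing K] (n : ℕ) : MvPolynomial (Fin n) K :=
  ∑ i : Fin n, X i ^ 2

lemma quadricSum_mem_sq (K : Type) [CommRing K] (n : ℕ) :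
    quadricSum K n ∈ (Ideal.span (Set.range (X : Fin n → MvPolynomial (Fin n) K))) ^ 2 := by
  refine Ideal.sum_mem _ fun i _ => ?_
  have hXi : (X i : MvPolynomial (Fin n) K) ∈
      Ideal.span (Set.range (X : Fin n → MvPolynomial (Fin n) K)) :=
    Ideal.subset_span ⟨i, rfl⟩
  exact Ideal.pow_mem_pow hXi 2

lemma quadricSum_smul_mem (K : Type) [CommRing K] (n : ℕ) {q s : ℤ}
    (h : s.toNat ≤ q.toNat + 2) :
    ∀ x ∈ degGE K n q,
      (LinearMap.lsmul (MvPolynomial (Fin n) K) (MvPolynomial (Fin n) K)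
        (quadricSum K n)) x ∈ degGE K n s := by
  intro x hx
  simp only [LinearMap.lsmul_apply, smul_eq_mul]
  have h2 : quadricSum K n * x ∈
      (Ideal.span (Set.range (X : Fin n → MvPolynomial (Fin n) K))) ^ (2 + q.toNat) := by
    rw [pow_add]
    exact Ideal.mul_mem_mul (quadricSum_mem_sq K n) hx
  exact Ideal.pow_le_pow_right (by omega) h2

/-- Multiplication by `f` as map `R^{≥q} → R^{≥s}` (for `s ≤ q + 2`). -/
def quadricMulMap (K : Type) [CommRing K] (n : ℕ) (q s : ℤ) (h : s.toNat ≤ q.toNat + 2) :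
    ↥(degGE K n q) →ₗ[MvPolynomial (Fin n) K] ↥(degGE K n s) :=
  (LinearMap.lsmul (MvPolynomial (Fin n) K) (MvPolynomial (Fin n) K)
    (quadricSum K n)).restrict (quadricSum_smul_mem K n h)

/-- Even-dimensional case: `G_p`, the cokernel of `f : R^{≥p−m} → R^{≥p−m+2}`, i.e. the
graded piece `Gr^F_p M` for the intersection cohomology Hodge module of the quadric cone. -/
def quadricGradedEven (K : Type) [CommRing K] (m : ℕ) (p : ℕ) : Type :=
  ↥(degGE K (2 * m) ((p : ℤ) - m + 2)) ⧸
    LinearMap.range (quadricMulMap K (2 * m) ((p : ℤ) - m) ((p : ℤ) - m + 2) (by omega))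

instance (K : Type) [CommRing K] (m p : ℕ) : AddCommGroup (quadricGradedEven K m p) :=
  inferInstanceAs (AddCommGroup (_ ⧸ _))

instance (K : Type) [CommRing K] (m p : ℕ) :
    Module (MvPolynomial (Fin (2 * m)) K) (quadricGradedEven K m p) :=
  inferInstanceAs (Module _ (_ ⧸ _))

/-- `Ext^j_R(G_p, R)` in the even case. -/
def quadricExtEven (K : Type) [CommRing K] (m : ℕ) (p : ℕ) (j : ℕ) :
    ModuleCat (MvPolynomial (Fin (2 * m)) K) :=
  ((Ext (MvPolynomial (Fin (2 * m)) K) (ModuleCat (MvPolynomial (Fin (2 * m)) K)) j).obj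
      (op (ModuleCat.of (MvPolynomial (Fin (2 * m)) K) (quadricGradedEven K m p)))).obj
    (ModuleCat.of (MvPolynomial (Fin (2 * m)) K) (MvPolynomial (Fin (2 * m)) K))

/-- The image in `R/(f)` of the polynomials of total degree `≤ d`, as a `K`-subspace. -/
def imageLowDegree (K : Type) [Field K] (n : ℕ) (d : ℕ) :
    Submodule K
      (MvPolynomial (Fin n) K ⧸ Ideal.span {quadricSum K n}) :=
  Submodule.map (Ideal.Quotient.mkₐ K (Ideal.span {quadricSum K n})).toLinearMap
    (restrictTotalDegree (Fin n) K d)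

section compare
variable {R : Type} [CommRing R]

lemma homology_iso_of_surj (S : ShortComplex (ModuleCat.{0} R)) (E : ModuleCat.{0} R)
    (φ : LinearMap.ker S.g.hom →ₗ[R] E) (hs : Function.Surjective φ)
    (hk : ∀ x, φ x = 0 ↔ ∃ y, S.f.hom y = x.1) : Nonempty (S.homology ≅ E) := by
  refine ⟨S.moduleCatHomologyIso ≪≫ LinearEquiv.toModuleIso
    ((Submodule.quotEquivOfEq _ _ ?_).trans (φ.quotKerEquivOfSurjective hs))⟩
  ext x
  simp only [LinearMap.mem_range, LinearMap.mem_ker]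
  rw [hk]
  constructor
  · rintro ⟨y, rfl⟩
    exact ⟨y, rfl⟩
  · rintro ⟨y, hy⟩
    exact ⟨y, Subtype.ext hy⟩

lemma smul_extMk {X Y : ModuleCat.{0} R} (P : ProjectiveResolution X) {n : ℕ} (r : R)
    (f : P.complex.X n ⟶ Y) (m : ℕ) (hm : n + 1 = m) (hf : P.complex.d m n ≫ f = 0) :
    r • P.extMk f m hm hf = P.extMk (r • f) m hm (by simp [hf]) := by
  rw [Abelian.Ext.smul_eq_comp_mk₀, P.extMk_comp_mk₀]
  congr 1

/-- cocycles to Ext -/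
def cocycleToExt {X Y : ModuleCat.{0} R} (P : ProjectiveResolution X) (n m : ℕ) (hm : n + 1 = m)
    : LinearMap.ker ((P.complex.linearYonedaObj R Y).d n m).hom →ₗ[R] Abelian.Ext X Y n where
  toFun f := P.extMk (show P.complex.X n ⟶ Y from f.1) m hm f.2
  map_add' _ _ := (P.add_extMk _ _ _ _ _ _).symm
  map_smul' r _ := (smul_extMk P r _ _ _ _).symm

lemma ext_compare (X Y : ModuleCat.{0} R) (n : ℕ) :
    Nonempty (((Ext R (ModuleCat.{0} R) (n+1)).obj (op X)).obj Y ≅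
      ModuleCat.of R (Abelian.Ext X Y (n+1))) := by
  let P := projectiveResolution X
  let K := P.complex.linearYonedaObj R Y
  obtain ⟨e⟩ := homology_iso_of_surj (K.sc' n (n+1) (n+2)) (ModuleCat.of R (Abelian.Ext X Y (n+1)))
    (cocycleToExt P (n+1) (n+2) rfl) (by
      intro α
      obtain ⟨f, hf, h⟩ := P.extMk_surjective α (n+2) rfl
      exact ⟨⟨f, hf⟩, h⟩) (by
      intro f
      exact (P.extMk_eq_zero_iff _ (n+2) rfl f.2 n rfl))
  exact ⟨P.isoExt (n+1) Y ≪≫ ShortComplex.homologyMapIso (K.isoSc' n (n+1) (n+2) (by simp) (by simp)) ≪≫ e⟩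

lemma ext_zero_subsingleton (X Y : ModuleCat.{0} R) (h : ∀ f : X ⟶ Y, f = 0) :
    Subsingleton (((Ext R (ModuleCat.{0} R) 0).obj (op X)).obj Y) := by
  let P := projectiveResolution X
  let K := P.complex.linearYonedaObj R Y
  rw [← ModuleCat.isZero_iff_subsingleton]
  refine Limits.IsZero.of_iso ?_ (P.isoExt 0 Y)
  rw [← HomologicalComplex.exactAt_iff_isZero_homology]
  rw [HomologicalComplex.exactAt_iff' _ 0 0 1 (by simp) (by simp)]
  rw [ShortComplex.moduleCat_exact_iff]
  intro f hf
  refine ⟨0, ?_⟩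
  rw [map_zero]
  symm
  change (show P.complex.X 0 ⟶ Y from f) = 0
  have hf : P.complex.d 1 0 ≫ (show P.complex.X 0 ⟶ Y from f) = 0 := hf
  have := P.exact₀.g_desc _ hf
  rw [← this, h (P.exact₀.desc _ hf)]
  exact Limits.comp_zero
end compare

section general
variable {R : Type} [CommRing R]

/-- `Ext` into the ring -/
abbrev ER (M : ModuleCat.{0} R) (j : ℕ) : Type := Abelian.Ext M (ModuleCat.of R R) j

/-- Ext concentrated in degree `i`, and isomorphic to `M` there. -/
def CM (i : ℕ) (M : ModuleCat.{0} R) : Prop :=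
  (∀ j, j ≠ i → Subsingleton (ER M j)) ∧ Nonempty (ER M i ≃ₗ[R] M)

def pre {M N : ModuleCat.{0} R} (f : M ⟶ N) (j : ℕ) : ER N j →ₗ[R] ER M j :=
  (Abelian.Ext.mk₀ f).precompOfLinear R _ (zero_add j)

def del {S : ShortComplex (ModuleCat.{0} R)} (hS : S.ShortExact) (j : ℕ) :
    ER S.X₁ j →ₗ[R] ER S.X₃ (j+1) :=
  hS.extClass.precompOfLinear R _ (add_comm 1 j)

variable {S : ShortComplex (ModuleCat.{0} R)} (hS : S.ShortExact)

lemma exact_mid (hS : S.ShortExact) (j : ℕ) : Function.Exact (pre S.g j) (pre S.f j) := by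
  intro x
  constructor
  · intro h
    exact Abelian.Ext.contravariant_sequence_exact₂ hS _ x h
  · rintro ⟨y, rfl⟩
    change (Abelian.Ext.mk₀ S.f).comp ((Abelian.Ext.mk₀ S.g).comp y (by omega)) (by omega) = 0
    simp only [Abelian.Ext.mk₀_comp_mk₀_assoc, ShortComplex.zero, Abelian.Ext.mk₀_zero, Abelian.Ext.zero_comp]

lemma exact_left (j : ℕ) : Function.Exact (pre S.f j) (del hS j) := by
  intro x
  constructor
  · intro h
    exact Abelian.Ext.contravariant_sequence_exact₁ hS _ x (add_comm 1 j) h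
  · rintro ⟨y, rfl⟩
    change hS.extClass.comp ((Abelian.Ext.mk₀ S.f).comp y (by omega)) (by omega) = 0
    simp only [ShortComplex.ShortExact.extClass_comp_assoc]

lemma exact_right (j : ℕ) : Function.Exact (del hS j) (pre S.g (j+1)) := by
  intro x
  constructor
  · intro h
    exact Abelian.Ext.contravariant_sequence_exact₃ hS _ x h (add_comm 1 j)
  · rintro ⟨y, rfl⟩
    change (Abelian.Ext.mk₀ S.g).comp (hS.extClass.comp y (by omega)) (by omega) = 0
    simp only [ShortComplex.ShortExact.comp_extClass_assoc]

lemma pre_zero_inj (hS : S.ShortExact) : Function.Injective (pre S.g 0) := by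
  have := hS.epi_g
  exact Abelian.Ext.precomp_mk₀_injective_of_epi _ S.g

def preEquiv {M N : ModuleCat.{0} R} (e : M ≅ N) (j : ℕ) : ER N j ≃ₗ[R] ER M j :=
  LinearEquiv.ofLinearMap (pre e.hom j) (pre e.inv j)
    (by
      ext x
      change (Abelian.Ext.mk₀ e.hom).comp ((Abelian.Ext.mk₀ e.inv).comp x (by omega)) (by omega) = x
      simp)
    (by
      ext x
      change (Abelian.Ext.mk₀ e.inv).comp ((Abelian.Ext.mk₀ e.hom).comp x (by omega)) (by omega) = x
      simp)

lemma CM.congr {M N : ModuleCat.{0} R} (e : M ≅ N) {i : ℕ} (h : CM i M) : CM i N := by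
  obtain ⟨h1, ⟨h2⟩⟩ := h
  refine ⟨fun j hj => ?_, ⟨(preEquiv e i).trans (h2.trans e.toLinearEquiv)⟩⟩
  have := h1 j hj
  exact (preEquiv e j).toEquiv.subsingleton

lemma CM_ring : CM 0 (ModuleCat.of R R) := by
  refine ⟨fun j hj => ?_, ⟨?_⟩⟩
  · obtain ⟨j, rfl⟩ := Nat.exists_eq_succ_of_ne_zero hj
    have : Projective (ModuleCat.of R R) := inferInstance
    exact Abelian.Ext.subsingleton_of_projective _ _ j
  · exact (Abelian.Ext.linearEquiv₀ (R := R)).trans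
      (ModuleCat.homLinearEquiv.trans (LinearMap.ringLmapEquivSelf R R R))

lemma CM_step {A B : ModuleCat.{0} R} (x : R) (g : A ⟶ B) (w : (x • 𝟙 A) ≫ g = 0)
    (hS : (ShortComplex.mk (x • 𝟙 A) g w).ShortExact) {i : ℕ} (h : CM i A) : CM (i+1) B := by
  obtain ⟨h1, ⟨e⟩⟩ := h
  have hpre : ∀ j (z : ER A j), pre (x • 𝟙 A) j z = x • z := by
    intro j z
    change (Abelian.Ext.mk₀ (x • 𝟙 A)).comp z (zero_add _) = _
    simp [Abelian.Ext.mk₀_smul]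
  have hreg : ∀ a : A, x • a = 0 → a = 0 := by
    have := hS.mono_f
    rw [ModuleCat.mono_iff_injective] at this
    intro a ha
    apply this
    rw [map_zero]
    exact ha
  have hg : ∀ j, ∀ y, pre g j y = 0 := by
    intro j y
    have h0 : x • pre g j y = 0 := by
      rw [← hpre]
      exact (exact_mid hS j (pre g j y)).2 ⟨y, rfl⟩
    by_cases hj : j = i
    · subst hj
      apply e.injective
      rw [map_zero]
      apply hreg
      rw [← map_smul, h0, map_zero]
    · have := h1 j hj
      exact Subsingleton.elim _ _
  have hsurj : ∀ j, Function.Surjective (del hS j) := fun j y =>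
    (exact_right hS j y).1 (hg _ y)
  refine ⟨fun j hj => ?_, ⟨?_⟩⟩
  · refine subsingleton_of_forall_eq 0 fun y => ?_
    rcases j with _ | j
    · apply pre_zero_inj hS
      rw [map_zero]
      exact hg 0 y
    · obtain ⟨z, rfl⟩ := hsurj j y
      have := h1 j (by omega)
      rw [Subsingleton.elim z 0, map_zero]
  · have hgs : Function.Surjective g.hom := by
      have := hS.epi_g
      rwa [ModuleCat.epi_iff_surjective] at this
    let φ : ER A i →ₗ[R] B := g.hom.comp e.toLinearMap
    have hφ : Function.Surjective φ := hgs.comp e.surjective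
    have hk : LinearMap.ker (del hS i) = LinearMap.ker φ := by
      ext z
      have hex := hS.exact
      rw [ShortComplex.moduleCat_exact_iff] at hex
      rw [LinearMap.mem_ker, LinearMap.mem_ker, exact_left hS i z]
      constructor
      · rintro ⟨y, rfl⟩
        change g.hom (e (pre (x • 𝟙 A) i y)) = 0
        rw [hpre, map_smul]
        have := congrArg (fun t => t.hom (e y)) w
        exact this
      · intro hz
        obtain ⟨a, ha⟩ := hex (e z) hz
        refine ⟨e.symm a, ?_⟩
        change pre (x • 𝟙 A) i _ = _
        rw [hpre, ← map_smul]
        apply e.injective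
        rw [e.apply_symm_apply]
        exact ha
    exact ((del hS i).quotKerEquivOfSurjective (hsurj i)).symm.trans
      ((Submodule.quotEquivOfEq _ _ hk).trans (φ.quotKerEquivOfSurjective hφ))

/-- Final step: `0 → G → Q → N → 0`. -/
lemma final_step (hS : S.ShortExact) (n : ℕ) (hn : 3 ≤ n) (hQ : CM 1 S.X₂)
    (hN : ∀ j, j ≠ n → Subsingleton (ER S.X₃ j)) :
    (∀ j, j ≠ 1 → j ≠ n - 1 → Subsingleton (ER S.X₁ j)) ∧
    Nonempty (ER S.X₁ 1 ≃ₗ[R] S.X₂) ∧ Nonempty (ER S.X₁ (n-1) ≃ₗ[R] ER S.X₃ n) := by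
  obtain ⟨h1, ⟨e⟩⟩ := hQ
  obtain ⟨n, rfl⟩ : ∃ l, n = l + 1 := ⟨n - 1, by omega⟩
  have hps : ∀ j, j ≠ n + 1 - 1 → Function.Surjective (pre S.f j) := by
    intro j hj y
    have := hN (j+1) (by omega)
    exact (exact_left hS j y).1 (Subsingleton.elim _ _)
  refine ⟨fun j hj hj' => ?_, ⟨?_⟩, ⟨?_⟩⟩
  · have := h1 j hj
    exact (hps j hj').subsingleton
  · refine (LinearEquiv.ofBijective (pre S.f 1) ⟨?_, hps 1 (by omega)⟩).symm.trans e
    rw [injective_iff_map_eq_zero]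
    intro y hy
    obtain ⟨z, rfl⟩ := (exact_mid hS 1 y).1 hy
    have := hN 1 (by omega)
    rw [Subsingleton.elim z 0, map_zero]
  · refine LinearEquiv.ofBijective (del hS n) ⟨?_, ?_⟩
    · rw [injective_iff_map_eq_zero]
      intro y hy
      obtain ⟨z, rfl⟩ := (exact_left hS n y).1 hy
      have := h1 n (by omega)
      rw [Subsingleton.elim z 0, map_zero]
    · intro y
      have := h1 (n+1) (by omega)
      exact (exact_right hS n y).1 (Subsingleton.elim _ _)

end general

section finlen
variable (k : Type) [Field k] {R : Type} [CommRing R] [Algebra k R]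

def rsEquiv {A B : Type} [AddCommGroup A] [AddCommGroup B] [Module R A] [Module R B]
    (f : A ≃ₗ[R] B) : RestrictScalars k R A ≃ₗ[k] RestrictScalars k R B where
  toFun := f
  invFun := f.symm
  map_add' := f.map_add
  map_smul' r x := f.map_smul (algebraMap k R r) x
  left_inv := f.left_inv
  right_inv := f.right_inv

lemma split_aux {A B C : Type} [AddCommGroup A] [AddCommGroup B] [AddCommGroup C]
    [Module k A] [Module k B] [Module k C] (f : A →ₗ[k] B) (g : B →ₗ[k] C)
    (hf : Function.Injective f) (hg : Function.Surjective g) (h : Function.Exact f g) :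
    Nonempty (B ≃ₗ[k] A × C) := by
  obtain ⟨l, hl⟩ := g.exists_rightInverse_of_surjective (LinearMap.range_eq_top.2 hg)
  exact ⟨(h.splitSurjectiveEquiv hf ⟨l, hl⟩).1⟩

lemma split_of_exact {A B C : Type} [AddCommGroup A] [AddCommGroup B] [AddCommGroup C]
    [Module R A] [Module R B] [Module R C] (f : A →ₗ[R] B) (g : B →ₗ[R] C)
    (hf : Function.Injective f) (hg : Function.Surjective g) (h : Function.Exact f g) :
    Nonempty (RestrictScalars k R B ≃ₗ[k] RestrictScalars k R A × RestrictScalars k R C) := by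
  let _ : Module k A := Module.compHom A (algebraMap k R)
  let _ : Module k B := Module.compHom B (algebraMap k R)
  let _ : Module k C := Module.compHom C (algebraMap k R)
  let f' : A →ₗ[k] B :=
    { toFun := f, map_add' := f.map_add, map_smul' := fun r x => f.map_smul (algebraMap k R r) x }
  let g' : B →ₗ[k] C :=
    { toFun := g, map_add' := g.map_add, map_smul' := fun r x => g.map_smul (algebraMap k R r) x }
  obtain ⟨e⟩ := split_aux k f' g' hf hg h
  exact ⟨{ toFun := e, invFun := e.symm, map_add' := e.map_add, map_smul' := e.map_smul,
           left_inv := e.left_inv, right_inv := e.right_inv }⟩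

def FL (n : ℕ) (M : ModuleCat.{0} R) : Prop :=
  (∀ j, j ≠ n → Subsingleton (ER M j)) ∧
    Nonempty (RestrictScalars k R (ER M n) ≃ₗ[k] RestrictScalars k R M)

lemma CM.FL {n : ℕ} {M : ModuleCat.{0} R} (h : CM n M) : FL k n M :=
  ⟨h.1, h.2.map (rsEquiv k)⟩

lemma FL_exact {S : ShortComplex (ModuleCat.{0} R)} (hS : S.ShortExact) {n : ℕ}
    (h1 : FL k n S.X₁) (h3 : FL k n S.X₃) : FL k n S.X₂ := by
  obtain ⟨h1, ⟨e1⟩⟩ := h1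
  obtain ⟨h3, ⟨e3⟩⟩ := h3
  refine ⟨fun j hj => ?_, ?_⟩
  · refine subsingleton_of_forall_eq 0 fun y => ?_
    have := h1 j hj
    have := h3 j hj
    obtain ⟨z, rfl⟩ := (exact_mid hS j y).1 (Subsingleton.elim _ _)
    rw [Subsingleton.elim z 0, map_zero]
  · have hinj : Function.Injective (pre S.g n) := by
      rcases n with _ | n
      · exact pre_zero_inj hS
      · rw [injective_iff_map_eq_zero]
        intro y hy
        obtain ⟨z, rfl⟩ := (exact_right hS n y).1 hy
        have := h1 n (by omega)
        rw [Subsingleton.elim z 0, map_zero]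
    have hsurj : Function.Surjective (pre S.f n) := by
      intro y
      have := h3 (n+1) (by omega)
      exact (exact_left hS n y).1 (Subsingleton.elim _ _)
    obtain ⟨a⟩ := split_of_exact k (pre S.g n) (pre S.f n) hinj hsurj
      (exact_mid hS n)
    obtain ⟨b⟩ := split_of_exact k S.f.hom S.g.hom hS.moduleCat_injective_f
        hS.moduleCat_surjective_g (by
      have := hS.exact
      rw [ShortComplex.ShortExact.moduleCat_exact_iff_function_exact] at this
      exact this)
    exact ⟨a.trans ((e3.prodCongr e1).trans ((LinearEquiv.prodComm k _ _).trans b.symm))⟩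

lemma FL_of_finite [IsNoetherianRing R] (I : Ideal R) (hI : I.IsMaximal) (n b : ℕ)
    (hCM : CM n (ModuleCat.of R (R ⧸ I))) (M : Type) [AddCommGroup M] [Module R M]
    [hM : Module.Finite R M] (hann : I ^ b ≤ Module.annihilator R M) :
    FL k n (ModuleCat.of R M) := by
  revert hann
  induction hM using IsNoetherianRing.induction_on_isQuotientEquivQuotientPrime R with
  | subsingleton N =>
    intro _
    have hz : Limits.IsZero (ModuleCat.of R N) := ModuleCat.isZero_of_subsingleton _
    have hs : ∀ j, Subsingleton (ER (ModuleCat.of R N) j) := by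
      intro j
      refine subsingleton_of_forall_eq 0 fun y => ?_
      have : y = (Abelian.Ext.mk₀ (𝟙 (ModuleCat.of R N))).comp y (zero_add j) := by simp
      rw [this, hz.eq_of_src (𝟙 _) 0]
      simp
    refine ⟨fun j _ => hs j, ?_⟩
    have := hs n
    have : Subsingleton (RestrictScalars k R (ER (ModuleCat.of R N) n)) := hs n
    have : Subsingleton (RestrictScalars k R (ModuleCat.of R N)) := ‹Subsingleton N›
    exact ⟨LinearEquiv.ofSubsingleton _ _⟩
  | quotient N p e =>
    intro hann
    have hIp : I ≤ p.1 := by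
      apply p.2.le_of_pow_le (n := b)
      rwa [e.annihilator_eq, Ideal.annihilator_quotient] at hann
    have := hI.eq_of_le p.2.ne_top hIp
    subst this
    exact (hCM.congr e.symm.toModuleIso).FL k
  | exact N₁ N₂ N₃ f g hf hg hfg h₁ h₃ =>
    intro hann
    have hS : (ShortComplex.mk (ModuleCat.ofHom f) (ModuleCat.ofHom g) (by
        ext x; exact hfg.apply_apply_eq_zero x)).ShortExact := by
      refine ShortComplex.ShortExact.mk' ?_ ?_ ?_
      · rw [ShortComplex.ShortExact.moduleCat_exact_iff_function_exact]
        exact hfg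
      · rwa [ModuleCat.mono_iff_injective]
      · rwa [ModuleCat.epi_iff_surjective]
    exact FL_exact k hS (h₁ (hann.trans (f.annihilator_le_of_injective hf)))
      (h₃ (hann.trans (g.annihilator_le_of_surjective hg)))

end finlen

section poly

lemma CM_quot {R : Type} [CommRing R] (I J : Ideal R) (x : R) (hJ : J = I ⊔ Ideal.span {x})
    (hx : ∀ p, x * p ∈ I → p ∈ I) {i : ℕ} (h : CM i (ModuleCat.of R (R ⧸ I))) :
    CM (i+1) (ModuleCat.of R (R ⧸ J)) := by
  have hIJ : I ≤ J := hJ ▸ le_sup_left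
  have hxJ : x ∈ J := hJ ▸ Ideal.mem_sup_right (Ideal.mem_span_singleton_self x)
  let g : (R ⧸ I) →ₗ[R] (R ⧸ J) := Submodule.factor hIJ
  have hgm : ∀ p : R, g (Submodule.Quotient.mk p) = Submodule.Quotient.mk p := fun p => rfl
  have w : (x • 𝟙 (ModuleCat.of R (R ⧸ I))) ≫ ModuleCat.ofHom g = 0 := by
    ext p
    change g (x • (Submodule.Quotient.mk 1 : R ⧸ I)) = 0
    rw [← Submodule.Quotient.mk_smul, hgm, Submodule.Quotient.mk_eq_zero]
    simpa using hxJ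
  refine CM_step x (ModuleCat.ofHom g) w ?_ h
  refine ShortComplex.ShortExact.mk' ?_ ?_ ?_
  · rw [ShortComplex.moduleCat_exact_iff]
    intro y hy
    obtain ⟨p, rfl⟩ := Submodule.Quotient.mk_surjective _ (show R ⧸ I from y)
    have hp : p ∈ J := (Submodule.Quotient.mk_eq_zero J).1 hy
    rw [hJ] at hp
    obtain ⟨a, ha, c, hc, rfl⟩ := Submodule.mem_sup.1 hp
    obtain ⟨r, rfl⟩ := Ideal.mem_span_singleton'.1 hc
    refine ⟨(Submodule.Quotient.mk r : R ⧸ I), ?_⟩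
    change x • (Submodule.Quotient.mk r : R ⧸ I) = _
    rw [← Submodule.Quotient.mk_smul]
    refine (Submodule.Quotient.eq I).2 ?_
    have : x • r - (a + r * x) = -a := by rw [smul_eq_mul]; ring
    rw [this]
    exact I.neg_mem ha
  · rw [ModuleCat.mono_iff_injective]
    change Function.Injective (fun y : R ⧸ I => x • y)
    intro y z hyz
    obtain ⟨p, rfl⟩ := Submodule.Quotient.mk_surjective _ y
    obtain ⟨q, rfl⟩ := Submodule.Quotient.mk_surjective _ z
    simp only [← Submodule.Quotient.mk_smul] at hyz
    rw [Submodule.Quotient.eq] at hyz ⊢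
    apply hx
    rwa [mul_sub]
  · rw [ModuleCat.epi_iff_surjective]
    exact Submodule.factor_surjective hIJ

variable (k : Type) [Field k]

lemma CM_vars {n : ℕ} (s : Finset (Fin n)) : CM s.card (ModuleCat.of (MvPolynomial (Fin n) k)
    (MvPolynomial (Fin n) k ⧸ Ideal.span (X '' (s : Set (Fin n)) : Set (MvPolynomial (Fin n) k)))) := by
  classical
  induction s using Finset.induction_on with
  | empty =>
    rw [Finset.card_empty]
    exact CM_ring.congr (Submodule.quotEquivOfEqBot _ (by simp)).symm.toModuleIso
  | insert a s ha ih =>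
    rw [Finset.card_insert_of_notMem ha]
    refine CM_quot _ _ (X a) ?_ ?_ ih
    · rw [Finset.coe_insert, Set.image_insert_eq, Ideal.span_insert, sup_comm]
    · intro p hp
      rw [mem_ideal_span_X_image] at hp ⊢
      intro m hm
      obtain ⟨i, hi, h⟩ := hp (Finsupp.single a 1 + m) (by
        rw [mem_support_iff] at hm ⊢
        rwa [coeff_X_mul])
      refine ⟨i, hi, ?_⟩
      have : a ≠ i := by rintro rfl; exact ha hi
      simpa [Finsupp.single_apply, this] using h

lemma idealOfVars_isMaximal (n : ℕ) : (idealOfVars (Fin n) k).IsMaximal := by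
  have : idealOfVars (Fin n) k = RingHom.ker (constantCoeff (R := k) (σ := Fin n)) := by
    ext p
    rw [← pow_one (idealOfVars (Fin n) k), mem_pow_idealOfVars_iff', RingHom.mem_ker,
      constantCoeff_eq]
    constructor
    · intro h; exact h 0 (by simp)
    · intro h x hx
      have : x = 0 := by
        rw [← Finsupp.degree_eq_zero_iff]; omega
      rw [this, h]
  rw [this]
  exact RingHom.ker_isMaximal_of_surjective _ (fun c => ⟨C c, by simp⟩)

lemma CM_residue (n : ℕ) : CM n (ModuleCat.of (MvPolynomial (Fin n) k)
    (MvPolynomial (Fin n) k ⧸ idealOfVars (Fin n) k)) := by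
  have := CM_vars k (Finset.univ : Finset (Fin n))
  rwa [Finset.card_univ, Fintype.card_fin, Finset.coe_univ, Set.image_univ] at this

lemma mem_pow_iff_hc {n : ℕ} (b : ℕ) (p : MvPolynomial (Fin n) k) :
    p ∈ idealOfVars (Fin n) k ^ b ↔ ∀ d < b, homogeneousComponent d p = 0 := by
  rw [mem_pow_idealOfVars_iff']
  constructor
  · intro h d hd
    ext x
    rw [coeff_homogeneousComponent]
    split_ifs with hx
    · rw [h x (by omega), coeff_zero]
    · simp
  · intro h x hx
    have := congrArg (coeff x) (h _ hx)
    simpa [coeff_homogeneousComponent] using this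

lemma quadric_hom (n : ℕ) : (quadricSum k n).IsHomogeneous 2 := by
  refine IsHomogeneous.sum _ _ _ fun i _ => ?_
  simpa using (isHomogeneous_X k i).pow 2

lemma hc_quadric_mul {n : ℕ} (d : ℕ) (r : MvPolynomial (Fin n) k) :
    homogeneousComponent (2 + d) (quadricSum k n * r) =
      quadricSum k n * homogeneousComponent d r := by
  letI := MvPolynomial.gradedAlgebra (σ := Fin n) (R := k)
  have := DirectSum.coe_decompose_mul_add_of_left_mem (homogeneousSubmodule (Fin n) k)
    (i := 2) (j := d) (b := r) ((mem_homogeneousSubmodule _ _).2 (quadric_hom k n))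
  rw [← decomposition.decompose'_apply, ← decomposition.decompose'_apply]
  exact this

lemma hc_quadric_mul_low {n : ℕ} (d : ℕ) (hd : d < 2) (r : MvPolynomial (Fin n) k) :
    homogeneousComponent d (quadricSum k n * r) = 0 := by
  letI := MvPolynomial.gradedAlgebra (σ := Fin n) (R := k)
  have := DirectSum.coe_decompose_mul_of_left_mem_of_not_le (homogeneousSubmodule (Fin n) k)
    (i := 2) (n := d) (b := r) ((mem_homogeneousSubmodule _ _).2 (quadric_hom k n)) (by omega)
  rw [← decomposition.decompose'_apply]
  exact this

lemma quadric_ne_zero {n : ℕ} (hn : 0 < n) : quadricSum k n ≠ 0 := by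
  intro h
  have := congrArg (eval (Pi.single (⟨0, hn⟩ : Fin n) (1 : k))) h
  simp [quadricSum, Pi.single_apply] at this

lemma quadric_mul_mem {n : ℕ} (hn : 0 < n) (b : ℕ) (r : MvPolynomial (Fin n) k)
    (h : quadricSum k n * r ∈ idealOfVars (Fin n) k ^ b) :
    r ∈ idealOfVars (Fin n) k ^ (b - 2) := by
  rw [mem_pow_iff_hc] at h ⊢
  intro d hd
  have := h (2 + d) (by omega)
  rw [hc_quadric_mul] at this
  exact (mul_eq_zero.1 this).resolve_left (quadric_ne_zero k hn)

lemma CM_quadric {n : ℕ} (hn : 0 < n) : CM 1 (ModuleCat.of (MvPolynomial (Fin n) k)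
    (MvPolynomial (Fin n) k ⧸ Ideal.span {quadricSum k n})) := by
  refine CM_quot (i := 0) ⊥ _ (quadricSum k n) (by simp) ?_
    (CM_ring.congr (Submodule.quotEquivOfEqBot _ rfl).symm.toModuleIso)
  intro p hp
  rw [Ideal.mem_bot] at hp ⊢
  exact (mul_eq_zero.1 hp).resolve_left (quadric_ne_zero k hn)

/-- The quotient `R/(𝔪^b + (f))`. -/
abbrev lowIdeal (n b : ℕ) : Ideal (MvPolynomial (Fin n) k) :=
  idealOfVars (Fin n) k ^ b ⊔ Ideal.span {quadricSum k n}

lemma mem_lowIdeal_of_degree {n d : ℕ} (g : MvPolynomial (Fin n) k) (hg : g.totalDegree ≤ d)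
    (h : g ∈ lowIdeal k n (d+1)) : g ∈ Ideal.span {quadricSum k n} := by
  obtain ⟨a, ha, c, hc, rfl⟩ := Submodule.mem_sup.1 h
  obtain ⟨r, rfl⟩ := Ideal.mem_span_singleton'.1 hc
  rw [← sum_homogeneousComponent (a + r * quadricSum k n)]
  refine Ideal.sum_mem _ fun e he => ?_
  rw [Finset.mem_range] at he
  rw [map_add, (mem_pow_iff_hc k _ a).1 ha e (by omega), zero_add, mul_comm]
  by_cases he2 : e < 2
  · rw [hc_quadric_mul_low k e he2]
    exact Ideal.zero_mem _
  · obtain ⟨e, rfl⟩ : ∃ l, e = 2 + l := ⟨e - 2, by omega⟩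
    rw [hc_quadric_mul]
    exact Ideal.mul_mem_right _ _ (Ideal.mem_span_singleton_self _)

lemma exists_low (n d : ℕ) (p : MvPolynomial (Fin n) k) :
    ∃ q, q.totalDegree ≤ d ∧ p - q ∈ idealOfVars (Fin n) k ^ (d+1) := by
  refine ⟨∑ e ∈ Finset.range (d+1), homogeneousComponent e p, ?_, ?_⟩
  · refine totalDegree_finsetSum_le fun e he => ?_
    have := Finset.mem_range.1 he
    exact (homogeneousComponent_isHomogeneous e p).totalDegree_le.trans (by omega)
  · rw [mem_pow_idealOfVars_iff']
    intro x hx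
    simp [coeff_sum, coeff_homogeneousComponent, hx]

lemma low_equiv (n d : ℕ) : Nonempty (↥(imageLowDegree k n d) ≃ₗ[k]
    RestrictScalars k (MvPolynomial (Fin n) k) (MvPolynomial (Fin n) k ⧸ lowIdeal k n (d+1))) := by
  let g : (MvPolynomial (Fin n) k ⧸ Ideal.span {quadricSum k n}) →ₗ[MvPolynomial (Fin n) k]
    (MvPolynomial (Fin n) k ⧸ lowIdeal k n (d+1)) := Submodule.factor le_sup_right
  let φ : ↥(imageLowDegree k n d) →ₗ[k] RestrictScalars k (MvPolynomial (Fin n) k)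
      (MvPolynomial (Fin n) k ⧸ lowIdeal k n (d+1)) :=
    { toFun := fun x => g x.1
      map_add' := fun x y => g.map_add _ _
      map_smul' := fun r x => by
        have : r • x.1 = (algebraMap k (MvPolynomial (Fin n) k) r) • x.1 :=
          (algebraMap_smul _ r x.1).symm
        rw [Submodule.coe_smul, this]
        exact g.map_smul _ _ }
  refine ⟨LinearEquiv.ofBijective φ ⟨?_, ?_⟩⟩
  · rw [injective_iff_map_eq_zero]
    rintro ⟨x, p, hp, rfl⟩ h
    apply Subtype.ext
    refine Ideal.Quotient.eq_zero_iff_mem.2 (mem_lowIdeal_of_degree k p (d := d) ?_ ?_)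
    · exact (mem_restrictTotalDegree _ _ _).1 hp
    · exact (Submodule.Quotient.mk_eq_zero (lowIdeal k n (d+1))).1 h
  · intro y
    obtain ⟨p, rfl⟩ := Submodule.Quotient.mk_surjective (lowIdeal k n (d+1)) y
    obtain ⟨q, hq, hpq⟩ := exists_low k n d p
    refine ⟨⟨_, q, (mem_restrictTotalDegree _ _ _).2 hq, rfl⟩, ?_⟩
    symm
    refine (Submodule.Quotient.eq (lowIdeal k n (d+1))).2 (Submodule.mem_sup_left hpq)

lemma low_finite (n d : ℕ) : FiniteDimensional k ↥(imageLowDegree k n d) := by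
  have : FiniteDimensional k ↥(restrictTotalDegree (Fin n) k d) := by
    have hfin : Set.Finite {s : Fin n →₀ ℕ | (s.sum fun _ e => e) ≤ d} :=
      Finsupp.finite_of_degree_le d
    have := hfin.to_subtype
    exact Module.Finite.of_basis (basisRestrictSupport k
      {s : Fin n →₀ ℕ | (s.sum fun _ e => e) ≤ d})
  exact Module.Finite.map _ _

lemma low_FL (n b : ℕ) : FL k n (ModuleCat.of (MvPolynomial (Fin n) k)
    (MvPolynomial (Fin n) k ⧸ lowIdeal k n b)) := by
  refine FL_of_finite k _ (idealOfVars_isMaximal k n) n b (CM_residue k n) _ ?_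
  rw [Ideal.annihilator_quotient]
  exact le_sup_left

/-- `G → R/f` -/
def gMap (m p : ℕ) : quadricGradedEven k m p →ₗ[MvPolynomial (Fin (2*m)) k]
    (MvPolynomial (Fin (2*m)) k ⧸ Ideal.span {quadricSum k (2*m)}) :=
  Submodule.liftQ _ ((Submodule.mkQ (Ideal.span {quadricSum k (2*m)})).comp
    (Submodule.subtype (degGE k (2 * m) ((p : ℤ) - m + 2)))) (by
    rintro _ ⟨x, rfl⟩
    rw [LinearMap.mem_ker]
    refine (Submodule.Quotient.mk_eq_zero _).2 ?_
    exact Ideal.mul_mem_right _ _ (Ideal.mem_span_singleton_self _))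

lemma g_exact (m p : ℕ) (hm : 2 ≤ m) :
    ∃ S : ShortComplex (ModuleCat.{0} (MvPolynomial (Fin (2*m)) k)), S.ShortExact ∧
      S.X₁ = ModuleCat.of _ (quadricGradedEven k m p) ∧
      S.X₂ = ModuleCat.of _ (MvPolynomial (Fin (2*m)) k ⧸ Ideal.span {quadricSum k (2*m)}) ∧
      S.X₃ = ModuleCat.of _ (MvPolynomial (Fin (2*m)) k ⧸
        lowIdeal k (2*m) ((p : ℤ) - m + 2).toNat) := by
  let g : (MvPolynomial (Fin (2*m)) k ⧸ Ideal.span {quadricSum k (2*m)})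
    →ₗ[MvPolynomial (Fin (2*m)) k] (MvPolynomial (Fin (2*m)) k ⧸
        lowIdeal k (2*m) ((p : ℤ) - m + 2).toNat) := Submodule.factor le_sup_right
  have w : ∀ x, g (gMap k m p x) = 0 := by
    intro x
    obtain ⟨y, rfl⟩ := Submodule.Quotient.mk_surjective _ x
    exact (Submodule.Quotient.mk_eq_zero (lowIdeal k (2*m) ((p : ℤ) - m + 2).toNat)).2
      (Submodule.mem_sup_left y.2)
  refine ⟨ShortComplex.mk (ModuleCat.ofHom (gMap k m p)) (ModuleCat.ofHom g)
    (by ext x; exact w x), ?_, rfl, rfl, rfl⟩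
  refine ShortComplex.ShortExact.mk' ?_ ?_ ?_
  · rw [ShortComplex.moduleCat_exact_iff]
    intro y hy
    obtain ⟨q, rfl⟩ := Submodule.Quotient.mk_surjective (Ideal.span {quadricSum k (2*m)}) y
    have hq := (Submodule.Quotient.mk_eq_zero
      (lowIdeal k (2*m) ((p : ℤ) - m + 2).toNat)).1 hy
    obtain ⟨a, ha, c, hc, rfl⟩ := Submodule.mem_sup.1 hq
    refine ⟨Submodule.Quotient.mk ⟨a, ha⟩, ?_⟩
    refine (Submodule.Quotient.eq (Ideal.span {quadricSum k (2*m)})).2 ?_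
    simpa using hc
  · rw [ModuleCat.mono_iff_injective]
    change Function.Injective (gMap k m p)
    rw [injective_iff_map_eq_zero]
    intro x hx
    obtain ⟨⟨a, ha⟩, rfl⟩ := Submodule.Quotient.mk_surjective _ x
    have hx := (Submodule.Quotient.mk_eq_zero (Ideal.span {quadricSum k (2*m)})).1 hx
    obtain ⟨r, hr⟩ := Ideal.mem_span_singleton.1 hx
    change a = _ at hr
    subst hr
    have hr := quadric_mul_mem k (by omega) _ r ha
    refine (Submodule.Quotient.mk_eq_zero _).2 ⟨⟨r, ?_⟩, rfl⟩
    have : ((p : ℤ) - m + 2).toNat - 2 = ((p : ℤ) - m).toNat := by omega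
    rw [this] at hr
    exact hr
  · rw [ModuleCat.epi_iff_surjective]
    exact Submodule.factor_surjective le_sup_right

end poly

/-- (Example 4.3 of the paper, even case `n = 2m`.)  For
`R = k[x₁,…,xₙ]`, `f = x₁²+⋯+xₙ²` and `G_p = coker(f : R^{≥p−m} → R^{≥p−m+2})`:
(i) `Ext^j_R(G_p, R) = 0` for `j ∉ {1, n−1}`;
(ii) `Ext^1_R(G_p, R) ≅ R/(f)`;
(iii) `Ext^{n−1}_R(G_p, R)` is `k`-dual to the image in `R/(f)` of the polynomials of
degree `≤ p−m+1`. -/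
theorem quadric_cone_ext_computation_even (k : Type) [Field k] [CharZero k]
    (m : ℕ) (hm : 2 ≤ m) (p : ℕ) :
    (∀ j : ℕ, j ∉ ({1, 2 * m - 1} : Set ℕ) → Subsingleton ↥(quadricExtEven k m p j)) ∧
    Nonempty
      (quadricExtEven k m p 1 ≅
        ModuleCat.of (MvPolynomial (Fin (2 * m)) k)
          (MvPolynomial (Fin (2 * m)) k ⧸ Ideal.span {quadricSum k (2 * m)})) ∧
    ((m - 1 ≤ p →
        Nonempty
          ((RestrictScalars k (MvPolynomial (Fin (2 * m)) k)
              ↥(quadricExtEven k m p (2 * m - 1))) ≃ₗ[k]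
            Module.Dual k ↥(imageLowDegree k (2 * m) (p + 1 - m)))) ∧
      (p < m - 1 → Subsingleton ↥(quadricExtEven k m p (2 * m - 1)))) := by
  obtain ⟨S, hS, h1, h2, h3⟩ := g_exact k m p hm
  have hFL := low_FL k (2*m) ((p : ℤ) - m + 2).toNat
  obtain ⟨F1, ⟨F2⟩, ⟨F3⟩⟩ := final_step hS (2*m) (by omega)
    (by rw [h2]; exact CM_quadric k (by omega)) (by rw [h3]; exact hFL.1)
  obtain ⟨-, ⟨F4⟩⟩ := hFL
  rw [← h3] at F4
  rw [← h2]
  unfold quadricExtEven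
  rw [← h1]
  have e3 : 2 * m - 1 = (2 * m - 2) + 1 := by omega
  refine ⟨?_, ?_, ?_, ?_⟩
  · intro j hj
    simp only [Set.mem_insert_iff, Set.mem_singleton_iff, not_or] at hj
    have := F1 j hj.1 hj.2
    rcases j with _ | j
    · apply ext_zero_subsingleton
      intro f
      apply (Abelian.Ext.mk₀_bijective S.X₁ _).1
      exact Subsingleton.elim (α := ER S.X₁ 0) _ _
    · obtain ⟨e⟩ := ext_compare S.X₁ (ModuleCat.of _ (MvPolynomial (Fin (2 * m)) k)) j
      have : Subsingleton (ModuleCat.of (MvPolynomial (Fin (2 * m)) k) (Abelian.Ext S.X₁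
        (ModuleCat.of _ (MvPolynomial (Fin (2 * m)) k)) (j+1))) := this
      exact e.toLinearEquiv.injective.subsingleton
  · obtain ⟨e⟩ := ext_compare S.X₁ (ModuleCat.of _ (MvPolynomial (Fin (2 * m)) k)) 0
    exact ⟨e ≪≫ F2.toModuleIso⟩
  · intro hp
    rw [e3] at F3 ⊢
    obtain ⟨e⟩ := ext_compare S.X₁ (ModuleCat.of _ (MvPolynomial (Fin (2 * m)) k)) (2 * m - 2)
    have hb : ((p : ℤ) - m + 2).toNat = (p + 1 - m) + 1 := by omega
    rw [hb] at h3
    rw [h3] at F4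
    obtain ⟨E⟩ := low_equiv k (2 * m) (p + 1 - m)
    have := low_finite k (2 * m) (p + 1 - m)
    have D : ↥(imageLowDegree k (2 * m) (p + 1 - m)) ≃ₗ[k]
        Module.Dual k ↥(imageLowDegree k (2 * m) (p + 1 - m)) :=
      LinearEquiv.ofFinrankEq _ _ Subspace.dual_finrank_eq.symm
    rw [h3] at F3
    exact ⟨(rsEquiv k e.toLinearEquiv).trans ((rsEquiv k F3).trans (F4.trans (E.symm.trans D)))⟩
  · intro hp
    rw [e3] at F3 ⊢
    obtain ⟨e⟩ := ext_compare S.X₁ (ModuleCat.of _ (MvPolynomial (Fin (2 * m)) k)) (2 * m - 2)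
    have hb : ((p : ℤ) - m + 2).toNat = 0 := by omega
    rw [hb] at h3
    rw [h3] at F3 F4
    have hs : Subsingleton (MvPolynomial (Fin (2 * m)) k ⧸ lowIdeal k (2 * m) 0) :=
      Ideal.Quotient.subsingleton_iff.2 (by simp [lowIdeal])
    have hs2 : Subsingleton (RestrictScalars k (MvPolynomial (Fin (2 * m)) k)
      (ModuleCat.of (MvPolynomial (Fin (2 * m)) k)
        (MvPolynomial (Fin (2 * m)) k ⧸ lowIdeal k (2 * m) 0))) := hs
    exact ((F4.injective.comp (rsEquiv k F3).injective).comp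
      (rsEquiv k e.toLinearEquiv).injective).subsingleton
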